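/- The square of the 11-cycle admits a star 9-edge-coloring; that is, χ'_star(C_11²) ≤ 9. -/

import Mathlib

/-- A star `k`-edge-coloring of `G`: a proper edge-coloring (adjacent edges get
distinct colors) such that no path and no cycle with exactly four edges is
bicolored.  The walks `v₀v₁v₂v₃v₄` with consecutive vertices adjacent and with
`v₀,v₁,v₂,v₃` pairwise distinct and `v₁,v₂,v₃,v₄` pairwise distinct are exactly
the paths (when `v₀ ≠ v₄`) and cycles (when `v₀ = v₄`) with four edges; being
bicolored under a proper coloring means the colors alternate. -/
def IsStarEdgeColoring {V : Type*} (G : SimpleGraph V) {k : ℕ} (c : Sym2 V → Fin k) : Prop :=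
  (∀ ⦃u v w : V⦄, G.Adj u v → G.Adj u w → v ≠ w → c s(u, v) ≠ c s(u, w)) ∧
  (∀ v₀ v₁ v₂ v₃ v₄ : V, G.Adj v₀ v₁ → G.Adj v₁ v₂ → G.Adj v₂ v₃ → G.Adj v₃ v₄ →
    v₀ ≠ v₂ → v₀ ≠ v₃ → v₁ ≠ v₃ → v₁ ≠ v₄ → v₂ ≠ v₄ →
    ¬(c s(v₀, v₁) = c s(v₂, v₃) ∧ c s(v₁, v₂) = c s(v₃, v₄)))

/-- The star chromatic index of `G`: the least `k` such that `G` admits a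
star `k`-edge-coloring. -/
noncomputable def starChromaticIndex {V : Type*} (G : SimpleGraph V) : ℕ :=
  sInf {k : ℕ | ∃ c : Sym2 V → Fin k, IsStarEdgeColoring G c}

/-- The square `Cₙ²` of the cycle on `n` vertices: vertices `ZMod n`, with `i`
adjacent to `j` iff `i ≠ j` and `i - j ≡ ±1` or `±2 (mod n)`. -/
def cycleSq (n : ℕ) : SimpleGraph (ZMod n) :=
  SimpleGraph.fromRel (fun a b => a - b = 1 ∨ a - b = 2)

/-- The color of an edge of `C₁₁²` with endpoints `a` and `b`; the junk value is `0` off the edges. -/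
def cycleSqElevenColor (a b : ZMod 11) : Fin 9 :=
  let near : Fin 11 → Fin 9 := ![0, 4, 6, 5, 3, 8, 2, 1, 6, 5, 2]
  let far : Fin 11 → Fin 9 := ![1, 2, 7, 4, 0, 7, 4, 4, 3, 3, 7]
  if b - a = 1 then near a else if a - b = 1 then near b
  else if b - a = 2 then far a else if a - b = 2 then far b else 0

theorem cycleSqElevenColor_comm : ∀ a b, cycleSqElevenColor a b = cycleSqElevenColor b a := by
  decide +kernel

theorem cycleSq_eleven_adj_iff : ∀ a b : ZMod 11,
    (cycleSq 11).Adj a b ↔ (b - a = 1 ∨ b - a = 2 ∨ a - b = 1 ∨ a - b = 2) := by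
  simp only [cycleSq, SimpleGraph.fromRel_adj]
  decide +kernel

instance : DecidableRel (cycleSq 11).Adj := fun a b =>
  decidable_of_iff' _ (cycleSq_eleven_adj_iff a b)

theorem isStarEdgeColoring_cycleSqElevenColor :
    IsStarEdgeColoring (cycleSq 11)
      (Sym2.lift ⟨cycleSqElevenColor, cycleSqElevenColor_comm⟩) := by
  have proper : ∀ u v, (cycleSq 11).Adj u v → ∀ w, (cycleSq 11).Adj u w → v ≠ w →
      cycleSqElevenColor u v ≠ cycleSqElevenColor u w := by
    decide +kernel
  have star : ∀ v₀ v₁, (cycleSq 11).Adj v₀ v₁ → ∀ v₂, (cycleSq 11).Adj v₁ v₂ → v₀ ≠ v₂ →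
      ∀ v₃, (cycleSq 11).Adj v₂ v₃ → v₀ ≠ v₃ → v₁ ≠ v₃ →
      cycleSqElevenColor v₀ v₁ = cycleSqElevenColor v₂ v₃ →
      ∀ v₄, (cycleSq 11).Adj v₃ v₄ → v₁ ≠ v₄ → v₂ ≠ v₄ →
      cycleSqElevenColor v₁ v₂ ≠ cycleSqElevenColor v₃ v₄ := by
    decide +kernel
  refine ⟨fun u v w huv huw => proper u v huv w huw, ?_⟩
  rintro v₀ v₁ v₂ v₃ v₄ h₀₁ h₁₂ h₂₃ h₃₄ n₀₂ n₀₃ n₁₃ n₁₄ n₂₄ ⟨h, h'⟩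
  exact star v₀ v₁ h₀₁ v₂ h₁₂ n₀₂ v₃ h₂₃ n₀₃ n₁₃ h v₄ h₃₄ n₁₄ n₂₄ h'


/-- `χ'_star(C₁₁²) ≤ 9`: the square of the 11-cycle admits a star 9-edge-coloring. -/
theorem starChromaticIndex_cycleSq_eleven : starChromaticIndex (cycleSq 11) ≤ 9 := by
  exact Nat.sInf_le ⟨_, isStarEdgeColoring_cycleSqElevenColor⟩
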